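/- Let b be a nonzero element of 𝔽_q and let a ≥ n ≥ 1 be integers. Then P(s_{(aⁿ)} ↦ b) = Σ_{k≥1} Σ_{(c_1,…,c_k)} (q−1)^{k−1}/qⁿ · g_b(gcd(c_1, c_2, …, c_k, q−1)), where the inner sum is over all compositions (c_1,…,c_k) of n into k positive parts. -/

import Mathlib

open Finset Classical

/-- The Jacobi–Trudi matrix of a partition with `k` parts `lam 0 ≥ lam 1 ≥ …`,
with respect to a 1-indexed assignment `a : ℕ → F` of values to `h_1, h_2, …`.
The `(i,j)` entry (indices `0`-based) is `a (lam i - i + j)` if that subscript is `≥ 1`,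
is `1` if it is `0`, and is `0` if it is negative. -/
def JTmat (F : Type*) [Field F] (k : ℕ) (lam : ℕ → ℕ) (a : ℕ → F) :
    Matrix (Fin k) (Fin k) F :=
  Matrix.of fun i j =>
    if 1 ≤ (lam i : ℤ) - (i : ℤ) + (j : ℤ) then
      a ((lam i : ℤ) - (i : ℤ) + (j : ℤ)).toNat
    else if (lam i : ℤ) - (i : ℤ) + (j : ℤ) = 0 then 1 else 0

/-- Extend a tuple `b : Fin N → F` to a `1`-indexed assignment `ℕ → F`
(zero outside `{1, …, N}`). -/
def extFin {F : Type*} [Zero F] {N : ℕ} (b : Fin N → F) : ℕ → F :=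
  fun n => if h : 1 ≤ n ∧ n ≤ N then b ⟨n - 1, by omega⟩ else 0

/-- The probability that the Jacobi–Trudi determinant of the partition `lam`
(with `k` parts) equals `c`, when the values of `h_1, …, h_N` are chosen
uniformly at random in `F`. -/
noncomputable def probEq (F : Type*) [Field F] [Fintype F]
    (k : ℕ) (lam : ℕ → ℕ) (N : ℕ) (c : F) : ℚ :=
  ((Finset.univ.filter fun b : Fin N → F =>
      (JTmat F k lam (extFin b)).det = c).card : ℚ) / (Fintype.card F : ℚ) ^ N

/-- `lam` records a partition with `k` (positive, weakly decreasing) parts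
on the indices `0, …, k-1`. -/
def IsPartition (k : ℕ) (lam : ℕ → ℕ) : Prop :=
  (∀ i, i + 1 < k → lam (i + 1) ≤ lam i) ∧ ∀ i, i < k → 1 ≤ lam i

/-- `g_b(d) = d` if `d ∣ (q−1)/ord(b)`, and `0` otherwise (`ordb` is the
multiplicative order of `b`). -/
def gVal (q ordb d : ℕ) : ℕ := if d ∣ (q - 1) / ordb then d else 0


section Hankel

variable {F : Type*} [Field F]

/-- The `n × n` Hankel matrix of the coefficients of a power series. -/
noncomputable def hankelMat (n : ℕ) (h : PowerSeries F) : Matrix (Fin n) (Fin n) F :=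
  Matrix.of fun i j => PowerSeries.coeff ((i : ℕ) + j) h

/-- The determinant of the `n × n` Toeplitz matrix of the coefficients of a power series. -/
noncomputable def toeplitzDet (n : ℕ) (h : PowerSeries F) : F :=
  (Matrix.of fun i j : Fin n => PowerSeries.coeff ((i.rev : ℕ) + j) h).det

/-- Drop the first `c` coefficients of a power series. -/
noncomputable def dropCoeffs (c : ℕ) (h : PowerSeries F) : PowerSeries F :=
  PowerSeries.mk fun i => PowerSeries.coeff (i + c) h

@[simp]
theorem coeff_dropCoeffs (c i : ℕ) (h : PowerSeries F) :
    PowerSeries.coeff i (dropCoeffs c h) = PowerSeries.coeff (i + c) h := by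
  simp [dropCoeffs]

/-- The lower triangular `n × n` Toeplitz matrix of a power series. -/
noncomputable def lowerToeplitz (n : ℕ) (v : PowerSeries F) : Matrix (Fin n) (Fin n) F :=
  Matrix.of fun i j => if j ≤ i then PowerSeries.coeff ((i : ℕ) - j) v else 0

/-- The sign of the permutation reversing `n` elements. -/
def revSign (F : Type*) [Field F] (n : ℕ) : F := ∏ j ∈ Finset.range n, (-1) ^ j

theorem sign_revPerm (n : ℕ) : ((Equiv.Perm.sign (@Fin.revPerm n) : ℤ) : F) = revSign F n := by
  rw [Equiv.Perm.sign_eq_prod_prod_Iio, revSign, Finset.prod_range]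
  push_cast
  refine Finset.prod_congr rfl fun j _ => ?_
  rw [Finset.prod_congr rfl (g := fun _ => (-1 : F))]
  · simp
  · intro i hi
    have : i < j := by simpa using hi
    simp [this.not_gt]

theorem revSign_mul_self (n : ℕ) : revSign F n * revSign F n = 1 := by
  rw [revSign, ← Finset.prod_mul_distrib]
  refine Finset.prod_eq_one fun j _ => ?_
  rw [← mul_pow]; simp

theorem revSign_add (c m : ℕ) :
    revSign F (c + m) = revSign F c * revSign F m * (-1) ^ (c * m) := by
  rw [revSign, Finset.prod_range_add]
  simp only [pow_add, Finset.prod_mul_distrib, Finset.prod_const, Finset.card_range, ← pow_mul]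
  simp only [revSign]; ring

theorem det_submatrix_rev {n : ℕ} (M : Matrix (Fin n) (Fin n) F) :
    (M.submatrix Fin.rev id).det = revSign F n * M.det := by
  rw [← sign_revPerm]
  exact Matrix.det_permute Fin.revPerm M

theorem toeplitzDet_eq (n : ℕ) (h : PowerSeries F) :
    toeplitzDet n h = revSign F n * (hankelMat n h).det :=
  det_submatrix_rev (hankelMat n h)

theorem toeplitzDet_congr {n : ℕ} {h k : PowerSeries F}
    (hk : ∀ i, i + 1 < 2 * n → PowerSeries.coeff i h = PowerSeries.coeff i k) :
    toeplitzDet n h = toeplitzDet n k := by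
  unfold toeplitzDet
  congr 1
  ext i j
  simp only [Matrix.of_apply]
  exact hk _ (by omega)

theorem toeplitzDet_C_mul (n : ℕ) (x : F) (h : PowerSeries F) :
    toeplitzDet n (PowerSeries.C x * h) = x ^ n * toeplitzDet n h := by
  unfold toeplitzDet
  have := Matrix.det_smul
    (Matrix.of fun i j : Fin n => PowerSeries.coeff ((i.rev : ℕ) + j) h) x
  rw [Fintype.card_fin] at this
  rw [← this]
  congr 1
  ext i j
  simp

theorem toeplitzDet_X_pow_mul {n : ℕ} (hn : 1 ≤ n) (h : PowerSeries F) :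
    toeplitzDet n (PowerSeries.X ^ n * h) = 0 := by
  unfold toeplitzDet
  refine Matrix.det_eq_zero_of_row_eq_zero ⟨n - 1, by omega⟩ fun j => ?_
  simp only [Matrix.of_apply, Fin.val_rev]
  rw [PowerSeries.coeff_X_pow_mul', if_neg]
  omega

theorem sum_fin_ite_le {n i : ℕ} (hi : i < n) (g : ℕ → F) :
    ∑ a : Fin n, (if (a : ℕ) ≤ i then g a else 0) = ∑ a ∈ Finset.range (i + 1), g a := by
  rw [← Finset.sum_range (fun a => if a ≤ i then g a else 0), ← Finset.sum_filter]
  congr 1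
  ext a; simp; omega

theorem det_lowerToeplitz (n : ℕ) (v : PowerSeries F) :
    (lowerToeplitz n v).det = PowerSeries.constantCoeff v ^ n := by
  rw [Matrix.det_of_isLowerTriangular]
  · simp [lowerToeplitz]
  · intro i j hij
    have : i < j := hij
    simp [lowerToeplitz, not_le.mpr this]

/-- The row generating function of `lowerToeplitz * hankelMat`. -/
theorem sum_mul_coeff_eq {c : ℕ} {u v h : PowerSeries F} (huv : v * u = 1)
    (hh : PowerSeries.X * h = PowerSeries.X ^ c * u) (i b : ℕ) :
    ∑ a ∈ Finset.range (i + 1), PowerSeries.coeff (i - a) v * PowerSeries.coeff (a + b) h =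
      PowerSeries.coeff b (PowerSeries.mk (fun b => if i + b + 1 = c then (1 : F) else 0) -
        dropCoeffs (i + 1) v * (PowerSeries.X ^ c * u)) := by
  have hX : v * (PowerSeries.X ^ c * u) = PowerSeries.X ^ c := by
    rw [mul_left_comm, huv, mul_one]
  have h1 : PowerSeries.coeff (i + b + 1) (v * (PowerSeries.X ^ c * u)) =
      if i + b + 1 = c then (1 : F) else 0 := by
    rw [hX, PowerSeries.coeff_X_pow]
  rw [map_sub, PowerSeries.coeff_mk, ← h1, eq_sub_iff_add_eq, PowerSeries.coeff_mul,
    PowerSeries.coeff_mul, Finset.Nat.sum_antidiagonal_eq_sum_range_succ_mk,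
    Finset.Nat.sum_antidiagonal_eq_sum_range_succ_mk,
    show (i + b + 1).succ = (i + 1) + (b + 1) by omega, Finset.sum_range_add _ (i + 1) (b + 1)]
  congr 1
  · rw [← Finset.sum_range_reflect
      (fun a => PowerSeries.coeff (i - a) v * PowerSeries.coeff (a + b) h)]
    refine Finset.sum_congr rfl fun a ha => ?_
    have ha : a < i + 1 := by simpa using ha
    rw [← hh, show i - (i + 1 - 1 - a) = a by omega,
      show i + b + 1 - a = (i + 1 - 1 - a + b) + 1 by omega, PowerSeries.coeff_succ_X_mul]
  · refine Finset.sum_congr rfl fun r hr => ?_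
    simp only [coeff_dropCoeffs]
    rw [show i + b + 1 - (i + 1 + r) = b - r by omega, add_comm r]

theorem congr_hankelMat {n c : ℕ} {u v h : PowerSeries F} (huv : v * u = 1)
    (hh : PowerSeries.X * h = PowerSeries.X ^ c * u) (i j : Fin n) :
    (lowerToeplitz n v * hankelMat n h * (lowerToeplitz n v).transpose) i j =
      (if (i : ℕ) < c ∧ c ≤ i + j + 1 then PowerSeries.coeff ((i : ℕ) + j + 1 - c) v else 0) -
        (if c ≤ (j : ℕ) then PowerSeries.coeff ((i : ℕ) + j + 1 - c) v else 0) := by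
  have hX : v * (PowerSeries.X ^ c * u) = PowerSeries.X ^ c := by
    rw [mul_left_comm, huv, mul_one]
  set G : PowerSeries F := PowerSeries.mk (fun b => if (i : ℕ) + b + 1 = c then (1 : F) else 0) -
        dropCoeffs (i + 1) v * (PowerSeries.X ^ c * u) with hG
  have h1 (b : Fin n) : (lowerToeplitz n v * hankelMat n h) i b = PowerSeries.coeff b G := by
    rw [hG, ← sum_mul_coeff_eq huv hh, Matrix.mul_apply, ← sum_fin_ite_le i.2]
    refine Finset.sum_congr rfl fun a _ => ?_
    simp [lowerToeplitz, hankelMat]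
  have h2 : (lowerToeplitz n v * hankelMat n h * (lowerToeplitz n v).transpose) i j =
      PowerSeries.coeff j (G * v) := by
    rw [Matrix.mul_apply, PowerSeries.coeff_mul,
      Finset.Nat.sum_antidiagonal_eq_sum_range_succ_mk, ← sum_fin_ite_le j.2]
    refine Finset.sum_congr rfl fun b _ => ?_
    rw [h1]
    simp [lowerToeplitz]
  have h3 : G * v = PowerSeries.mk (fun b => if (i : ℕ) + b + 1 = c then (1 : F) else 0) * v -
      dropCoeffs (i + 1) v * PowerSeries.X ^ c := by
    rw [hG]; linear_combination -dropCoeffs (i + 1) v * hX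
  rw [h2, h3, map_sub, PowerSeries.coeff_mul_X_pow', coeff_dropCoeffs, PowerSeries.coeff_mul,
    Finset.Nat.sum_antidiagonal_eq_sum_range_succ_mk]
  congr 1
  · simp only [PowerSeries.coeff_mk, ite_mul, one_mul, zero_mul]
    split_ifs with hcond
    · rw [Finset.sum_eq_single (c - 1 - i)]
      · rw [if_pos (by omega)]; congr 2; omega
      · intro b _ hb; rw [if_neg (by omega)]
      · intro hb; simp at hb; omega
    · refine Finset.sum_eq_zero fun b hb => ?_
      simp at hb
      rw [if_neg (by omega)]
  · split_ifs with hcond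
    · congr 2; omega
    · rfl

theorem det_hankelMat_mul {c m : ℕ} (hc : 1 ≤ c) {u v h : PowerSeries F} (huv : v * u = 1)
    (hh : PowerSeries.X * h = PowerSeries.X ^ c * u) :
    (hankelMat (c + m) h).det * PowerSeries.constantCoeff v ^ (2 * (c + m)) =
      revSign F c * PowerSeries.constantCoeff v ^ c *
        (hankelMat m (-dropCoeffs (c + 1) v)).det := by
  have hdet : (lowerToeplitz (c + m) v * hankelMat (c + m) h *
      (lowerToeplitz (c + m) v).transpose).det =
      (hankelMat (c + m) h).det * PowerSeries.constantCoeff v ^ (2 * (c + m)) := by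
    rw [Matrix.det_mul, Matrix.det_mul, Matrix.det_transpose, det_lowerToeplitz]; ring
  have hblock : (lowerToeplitz (c + m) v * hankelMat (c + m) h *
      (lowerToeplitz (c + m) v).transpose).submatrix finSumFinEquiv finSumFinEquiv =
      Matrix.fromBlocks
        (Matrix.of fun i j : Fin c =>
          if c ≤ (i : ℕ) + j + 1 then PowerSeries.coeff ((i : ℕ) + j + 1 - c) v else 0)
        0 0 (hankelMat m (-dropCoeffs (c + 1) v)) := by
    ext i j
    rw [Matrix.submatrix_apply, congr_hankelMat huv hh]
    rcases i with i | i <;> rcases j with j | j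
    · simp [not_le.mpr j.2]
    · rw [if_pos, if_pos] <;> simp; omega
    · simp [not_le.mpr j.2]
    · simp [hankelMat]
      congr 2; omega
  have hanti : (Matrix.of fun i j : Fin c =>
      if c ≤ (i : ℕ) + j + 1 then PowerSeries.coeff ((i : ℕ) + j + 1 - c) v else 0).det =
      revSign F c * PowerSeries.constantCoeff v ^ c := by
    rw [← one_mul (Matrix.det _), ← revSign_mul_self (F := F) c, mul_assoc, ← det_submatrix_rev]
    congr 1
    rw [Matrix.det_of_isUpperTriangular]
    · simp only [Matrix.submatrix_apply, Matrix.of_apply, id]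
      rw [Finset.prod_congr rfl (g := fun _ => PowerSeries.constantCoeff v)]
      · simp
      · intro i _
        rw [Fin.val_rev, if_pos (by omega), ← PowerSeries.coeff_zero_eq_constantCoeff_apply]
        congr 2; omega
    · intro i j hij
      have : j < i := hij
      simp only [Matrix.submatrix_apply, Matrix.of_apply, id]
      rw [Fin.val_rev, if_neg (by omega)]
  rw [← hdet, ← Matrix.det_submatrix_equiv_self finSumFinEquiv, hblock,
    Matrix.det_fromBlocks_zero₂₁, hanti]

/-- Stripping the leading zeros and the first block off a Toeplitz determinant. -/
theorem toeplitzDet_X_pow_mul_inv {d m : ℕ} {v : PowerSeries F}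
    (hv : PowerSeries.constantCoeff v ≠ 0) :
    toeplitzDet (d + 1 + m) (PowerSeries.X ^ d * v⁻¹) =
      ((-1) ^ m * (PowerSeries.constantCoeff v)⁻¹) ^ (d + 1) *
        toeplitzDet m (PowerSeries.C (-(PowerSeries.constantCoeff v)⁻¹ ^ 2) *
          dropCoeffs (d + 1 + 1) v) := by
  have key := det_hankelMat_mul (m := m) (c := d + 1) (by omega)
    (PowerSeries.mul_inv_cancel v hv) (h := PowerSeries.X ^ d * v⁻¹) (by ring)
  have hneg : -dropCoeffs (d + 1 + 1) v = PowerSeries.C (-1) * dropCoeffs (d + 1 + 1) v := by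
    simp
  have h2 := toeplitzDet_eq m (-dropCoeffs (d + 1 + 1) v)
  rw [hneg, toeplitzDet_C_mul] at h2
  rw [toeplitzDet_C_mul, toeplitzDet_eq, revSign_add]
  rw [hneg] at key
  set x := PowerSeries.constantCoeff v
  have h3 : (hankelMat m (PowerSeries.C (-1) * dropCoeffs (d + 1 + 1) v)).det =
      revSign F m * ((-1) ^ m * toeplitzDet m (dropCoeffs (d + 1 + 1) v)) := by
    rw [h2, ← mul_assoc, revSign_mul_self, one_mul]
  rw [h3] at key
  have h4 : (hankelMat (d + 1 + m) (PowerSeries.X ^ d * v⁻¹)).det =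
      x⁻¹ ^ (2 * (d + 1 + m)) * (revSign F (d + 1) * x ^ (d + 1) *
      (revSign F m * ((-1) ^ m * toeplitzDet m (dropCoeffs (d + 1 + 1) v)))) := by
    rw [← key, inv_pow]
    field_simp
  rw [h4]
  have e1 := revSign_mul_self (F := F) (d + 1)
  have e2 := revSign_mul_self (F := F) m
  have e3 : x⁻¹ ^ (2 * (d + 1 + m)) * x ^ (d + 1) = x⁻¹ ^ (d + 1) * (x⁻¹ ^ 2) ^ m := by
    rw [← pow_mul, ← pow_add, show 2 * (d + 1 + m) = (d + 1 + 2 * m) + (d + 1) by ring, pow_add _ (d + 1 + 2 * m),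
      mul_assoc, ← mul_pow, inv_mul_cancel₀ hv, one_pow, mul_one]
  rw [mul_pow, neg_pow (x⁻¹ ^ 2), ← pow_mul, mul_comm m (d + 1)]
  linear_combination (revSign F m * revSign F m * (-1) ^ ((d + 1) * m) * (-1) ^ m *
      toeplitzDet m (dropCoeffs (d + 1 + 1) v) * (x⁻¹ ^ (2 * (d + 1 + m)) * x ^ (d + 1))) * e1 +
    ((-1) ^ ((d + 1) * m) * (-1) ^ m *
      toeplitzDet m (dropCoeffs (d + 1 + 1) v) * (x⁻¹ ^ (2 * (d + 1 + m)) * x ^ (d + 1))) * e2 +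
    ((-1) ^ ((d + 1) * m) * (-1) ^ m * toeplitzDet m (dropCoeffs (d + 1 + 1) v)) * e3

end Hankel

section SeriesSum

variable {F : Type*} [Field F]

/-- The polynomial with prescribed first `N` coefficients, as a power series. -/
noncomputable def truncSeries {N : ℕ} (t : Fin N → F) : PowerSeries F :=
  PowerSeries.mk fun i => if h : i < N then t ⟨i, h⟩ else 0

theorem coeff_truncSeries {N : ℕ} (t : Fin N → F) {i : ℕ} (h : i < N) :
    PowerSeries.coeff i (truncSeries t) = t ⟨i, h⟩ := by
  simp [truncSeries, h]

theorem truncSeries_cons {N : ℕ} (x : F) (t : Fin N → F) :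
    truncSeries (Fin.cons x t : Fin (N + 1) → F) =
      PowerSeries.C x + PowerSeries.X * truncSeries t := by
  ext i
  cases i with
  | zero => simp [truncSeries]
  | succ i =>
    rw [map_add, PowerSeries.coeff_succ_X_mul, PowerSeries.coeff_C, if_neg (by omega), zero_add]
    by_cases h : i < N
    · have h' : i + 1 < N + 1 := by omega
      rw [coeff_truncSeries _ h', coeff_truncSeries _ h]
      exact Fin.cons_succ (α := fun _ => F) x t ⟨i, h⟩
    · simp [truncSeries, h]

theorem coeff_inv_congr {N : ℕ} {h k : PowerSeries F} (hh : PowerSeries.constantCoeff h ≠ 0)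
    (hk : PowerSeries.constantCoeff k ≠ 0)
    (hc : ∀ i < N, PowerSeries.coeff i h = PowerSeries.coeff i k) :
    ∀ i < N, PowerSeries.coeff i h⁻¹ = PowerSeries.coeff i k⁻¹ := by
  have h1 : PowerSeries.X ^ N ∣ k - h :=
    PowerSeries.X_pow_dvd_iff.mpr fun i hi => by simp [hc i hi]
  have h2 : h⁻¹ - k⁻¹ = (k - h) * (h⁻¹ * k⁻¹) := by
    linear_combination k⁻¹ * PowerSeries.mul_inv_cancel h hh -
      h⁻¹ * PowerSeries.mul_inv_cancel k hk
  have h3 := PowerSeries.X_pow_dvd_iff.mp (h2 ▸ h1.mul_right (h⁻¹ * k⁻¹))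
  intro i hi
  simpa [sub_eq_zero] using h3 i hi

theorem inv_inv_of_constantCoeff_ne_zero {h : PowerSeries F}
    (hh : PowerSeries.constantCoeff h ≠ 0) : h⁻¹⁻¹ = h := by
  rw [PowerSeries.inv_eq_iff_mul_eq_one (by simpa using hh), PowerSeries.mul_inv_cancel h hh]

variable [Fintype F]

/-- The sum of `f` over all power series supported on the first `N` coefficients. -/
noncomputable def seriesSum (N : ℕ) (f : PowerSeries F → ℚ) : ℚ :=
  ∑ t : Fin N → F, f (truncSeries t)

theorem seriesSum_succ (N : ℕ) (f : PowerSeries F → ℚ) :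
    seriesSum (N + 1) f =
      ∑ x : F, seriesSum N fun h => f (PowerSeries.C x + PowerSeries.X * h) := by
  unfold seriesSum
  rw [← (Fin.consEquiv fun _ : Fin (N + 1) => F).sum_comp, Fintype.sum_prod_type]
  refine Finset.sum_congr rfl fun x _ => Finset.sum_congr rfl fun t _ => ?_
  exact congrArg f (truncSeries_cons x t)

theorem seriesSum_zero (f : PowerSeries F → ℚ) : seriesSum 0 f = f 0 := by
  have (t : Fin 0 → F) : truncSeries t = 0 := by ext i; simp [truncSeries]
  simp [seriesSum, this]

theorem seriesSum_succ_of_congr {N : ℕ} {f : PowerSeries F → ℚ}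
    (hf : ∀ h k, (∀ i < N, PowerSeries.coeff i h = PowerSeries.coeff i k) → f h = f k) :
    seriesSum (N + 1) f = Fintype.card F * seriesSum N f := by
  induction N generalizing f with
  | zero =>
    rw [seriesSum_succ]
    have (x : F) : f (PowerSeries.C x) = f 0 := hf _ _ (by simp)
    simp [seriesSum_zero, this]
  | succ N ih =>
    rw [seriesSum_succ, seriesSum_succ, Finset.mul_sum]
    refine Finset.sum_congr rfl fun x _ => ih fun h k hk => hf _ _ fun i hi => ?_
    cases i with
    | zero => simp
    | succ i => simpa [PowerSeries.coeff_succ_X_mul] using hk i (by omega)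

theorem seriesSum_dropCoeffs (c N : ℕ) (f : PowerSeries F → ℚ) :
    seriesSum (N + c) (fun h => f (dropCoeffs c h)) = Fintype.card F ^ c * seriesSum N f := by
  induction c with
  | zero =>
    have (h : PowerSeries F) : dropCoeffs 0 h = h := by ext; simp
    simp [this]
  | succ c ih =>
    have (x : F) (h : PowerSeries F) :
        dropCoeffs (c + 1) (PowerSeries.C x + PowerSeries.X * h) = dropCoeffs c h := by
      ext i
      rw [coeff_dropCoeffs, coeff_dropCoeffs, map_add, ← add_assoc, PowerSeries.coeff_succ_X_mul,
        PowerSeries.coeff_C, if_neg (by omega), zero_add]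
    rw [← add_assoc, seriesSum_succ]
    simp only [this, ih, Finset.sum_const, Finset.card_univ, nsmul_eq_mul]
    ring

theorem seriesSum_C_mul (N : ℕ) {x : F} (hx : x ≠ 0) (f : PowerSeries F → ℚ) :
    seriesSum N (fun h => f (PowerSeries.C x * h)) = seriesSum N f := by
  unfold seriesSum
  rw [← (Equiv.piCongrRight fun _ : Fin N => Equiv.mulLeft₀ x hx).sum_comp
    fun t => f (truncSeries t)]
  refine Finset.sum_congr rfl fun t _ => congrArg f ?_
  ext i
  by_cases h : i < N <;> simp [truncSeries, h]

theorem seriesSum_inv {N : ℕ} {f : PowerSeries F → ℚ}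
    (hf : ∀ h k, (∀ i < N, PowerSeries.coeff i h = PowerSeries.coeff i k) → f h = f k) :
    seriesSum N (fun h => if PowerSeries.constantCoeff h ≠ 0 then f h else 0) =
      seriesSum N (fun h => if PowerSeries.constantCoeff h ≠ 0 then f h⁻¹ else 0) := by
  let ι : (Fin N → F) → Fin N → F := fun t i => PowerSeries.coeff i (truncSeries t)⁻¹
  have hι (t : Fin N → F) (i : ℕ) (hi : i < N) :
      PowerSeries.coeff i (truncSeries (ι t)) = PowerSeries.coeff i (truncSeries t)⁻¹ :=
    coeff_truncSeries _ hi
  have hne (t : Fin N → F) (ht : PowerSeries.constantCoeff (truncSeries t) ≠ 0) :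
      PowerSeries.constantCoeff (truncSeries (ι t)) ≠ 0 := by
    have hN : 0 < N := by
      by_contra hN
      simp [truncSeries, hN] at ht
    rw [← PowerSeries.coeff_zero_eq_constantCoeff_apply, hι t 0 hN]
    simpa using ht
  have hιι (t : Fin N → F) (ht : PowerSeries.constantCoeff (truncSeries t) ≠ 0) :
      ι (ι t) = t := by
    funext i
    have := coeff_inv_congr (hne t ht) (by simpa using ht) (hι t) i i.2
    rw [inv_inv_of_constantCoeff_ne_zero ht, coeff_truncSeries _ i.2] at this
    exact this
  unfold seriesSum
  rw [← Finset.sum_filter, ← Finset.sum_filter]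
  refine Finset.sum_nbij' ι ι ?_ ?_ ?_ ?_ ?_
  · intro t ht; simpa using hne t (by simpa using ht)
  · intro t ht; simpa using hne t (by simpa using ht)
  · intro t ht; exact hιι t (by simpa using ht)
  · intro t ht; exact hιι t (by simpa using ht)
  · intro t ht
    have ht : PowerSeries.constantCoeff (truncSeries t) ≠ 0 := by simpa using ht
    refine hf _ _ fun i hi => ?_
    rw [coeff_inv_congr (hne t ht) (by simpa using ht) (hι t) i hi,
      inv_inv_of_constantCoeff_ne_zero ht]

/-- Splitting a sum over power series according to their order. -/
theorem seriesSum_eq_sum_order (N k : ℕ) (f : PowerSeries F → ℚ) :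
    seriesSum (N + k) f =
      ∑ d ∈ Finset.range k, seriesSum (N + k - d)
        (fun u => if PowerSeries.constantCoeff u ≠ 0 then f (PowerSeries.X ^ d * u) else 0) +
      seriesSum N (fun u => f (PowerSeries.X ^ k * u)) := by
  induction k generalizing N with
  | zero => simp
  | succ k ih =>
    have hbase (g : PowerSeries F → ℚ) : seriesSum (N + 1) g =
        seriesSum (N + 1) (fun u => if PowerSeries.constantCoeff u ≠ 0 then g u else 0) +
          seriesSum N (fun u => g (PowerSeries.X * u)) := by
      rw [seriesSum_succ, seriesSum_succ, ← Finset.add_sum_erase _ _ (Finset.mem_univ (0 : F)),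
        ← Finset.add_sum_erase (a := (0 : F)) _ (fun x => seriesSum N fun h =>
          if PowerSeries.constantCoeff (PowerSeries.C x + PowerSeries.X * h) ≠ 0 then
            g (PowerSeries.C x + PowerSeries.X * h) else 0) (Finset.mem_univ _), add_comm]
      congr 1
      · rw [← zero_add (Finset.sum _ _)]
        congr 1
        · simp [seriesSum]
        · refine Finset.sum_congr rfl fun x hx => ?_
          have hx : x ≠ 0 := by simpa using hx
          simp [hx]
      · simp
    rw [show N + (k + 1) = N + 1 + k by ring, ih (N + 1), hbase, Finset.sum_range_succ,
      show N + 1 + k - k = N + 1 by omega]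
    simp only [pow_succ, mul_assoc]
    ring

/-- The number of truncated power series with Toeplitz determinant `b`. -/
noncomputable def toeplitzCount (n : ℕ) (b : F) : ℚ :=
  seriesSum (2 * n) fun h => if toeplitzDet n h = b then 1 else 0

theorem seriesSum_toeplitz_stratum (d m : ℕ) (b : Fˣ) :
    seriesSum (2 * m + (d + 1) + 1) (fun u : PowerSeries F =>
      if PowerSeries.constantCoeff u ≠ 0 then
        if toeplitzDet (d + 1 + m) (PowerSeries.X ^ d * u) = (b : F) then (1 : ℚ) else 0 else 0) =
      Fintype.card F ^ (d + 1) *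
        ∑ y : Fˣ, toeplitzCount m ((b * (y ^ (d + 1))⁻¹ : Fˣ) : F) := by
  rw [seriesSum_inv]
  swap
  · intro h k hk
    rw [toeplitzDet_congr (k := PowerSeries.X ^ d * k)]
    intro i hi
    rw [PowerSeries.coeff_X_pow_mul', PowerSeries.coeff_X_pow_mul']
    split_ifs
    · exact hk _ (by omega)
    · rfl
  have hstep (v : PowerSeries F) : (if PowerSeries.constantCoeff v ≠ 0 then
      if toeplitzDet (d + 1 + m) (PowerSeries.X ^ d * v⁻¹) = (b : F) then (1 : ℚ) else 0 else 0) =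
      if PowerSeries.constantCoeff v ≠ 0 then
        if ((-1) ^ m * (PowerSeries.constantCoeff v)⁻¹) ^ (d + 1) *
          toeplitzDet m (PowerSeries.C (-(PowerSeries.constantCoeff v)⁻¹ ^ 2) *
            dropCoeffs (d + 1 + 1) v) = (b : F) then (1 : ℚ) else 0 else 0 := by
    split_ifs with h1 <;> first | rfl | (rw [toeplitzDet_X_pow_mul_inv h1] at *; contradiction)
  simp only [hstep]
  have hdrop (x : F) (h : PowerSeries F) :
      dropCoeffs (d + 1 + 1) (PowerSeries.C x + PowerSeries.X * h) = dropCoeffs (d + 1) h := by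
    ext i
    rw [coeff_dropCoeffs, coeff_dropCoeffs, map_add, ← add_assoc, PowerSeries.coeff_succ_X_mul,
      PowerSeries.coeff_C, if_neg (by omega), zero_add]
  rw [seriesSum_succ, Finset.mul_sum]
  simp only [hdrop, map_add, map_mul, PowerSeries.constantCoeff_C, PowerSeries.constantCoeff_X,
    zero_mul, add_zero]
  have hunit (x : Fˣ) : seriesSum (2 * m + (d + 1)) (fun h : PowerSeries F =>
      if (x : F) ≠ 0 then if ((-1) ^ m * (x : F)⁻¹) ^ (d + 1) *
          toeplitzDet m (PowerSeries.C (-(x : F)⁻¹ ^ 2) * dropCoeffs (d + 1) h) = (b : F)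
          then (1 : ℚ) else 0 else 0) =
      Fintype.card F ^ (d + 1) *
        toeplitzCount m ((b * (((-1) ^ m * x⁻¹) ^ (d + 1))⁻¹ : Fˣ) : F) := by
    simp only [ne_eq, x.ne_zero, not_false_eq_true, if_true]
    rw [seriesSum_dropCoeffs (d + 1) (2 * m) (fun h : PowerSeries F =>
      if ((-1) ^ m * (x : F)⁻¹) ^ (d + 1) *
          toeplitzDet m (PowerSeries.C (-(x : F)⁻¹ ^ 2) * h) = (b : F) then (1 : ℚ) else 0),
      seriesSum_C_mul (2 * m) (x := -(x : F)⁻¹ ^ 2) (by simp) (fun h : PowerSeries F =>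
      if ((-1) ^ m * (x : F)⁻¹) ^ (d + 1) * toeplitzDet m h = (b : F) then (1 : ℚ) else 0)]
    unfold toeplitzCount
    congr 2
    funext h
    have hy : (((((-1) ^ m * x⁻¹) ^ (d + 1) : Fˣ)) : F) = ((-1) ^ m * (x : F)⁻¹) ^ (d + 1) := by
      simp
    rw [← hy]
    set y : Fˣ := ((-1) ^ m * x⁻¹) ^ (d + 1)
    simp only [Units.val_mul, Units.val_inv_eq_inv_val, eq_mul_inv_iff_mul_eq₀ y.ne_zero,
      mul_comm (y : F)]
  have hzero : seriesSum (2 * m + (d + 1)) (fun h : PowerSeries F =>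
      if (0 : F) ≠ 0 then if ((-1) ^ m * (0 : F)⁻¹) ^ (d + 1) *
          toeplitzDet m (PowerSeries.C (-(0 : F)⁻¹ ^ 2) * dropCoeffs (d + 1) h) = (b : F)
          then (1 : ℚ) else 0 else 0) = 0 := by
    simp [seriesSum]
  rw [← Finset.add_sum_erase _ _ (Finset.mem_univ (0 : F)), hzero, zero_add]
  trans ∑ x : Fˣ, Fintype.card F ^ (d + 1) *
        toeplitzCount m ((b * (((-1) ^ m * x⁻¹) ^ (d + 1))⁻¹ : Fˣ) : F)
  · symm
    refine Finset.sum_bij (fun x _ => (x : F)) (by simp) (by simp [Units.ext_iff]) ?_ ?_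
    · intro x hx
      exact ⟨Units.mk0 x (by simpa using hx), by simp⟩
    · intro x _
      exact (hunit x).symm
  · exact ((Equiv.inv Fˣ).trans (Equiv.mulLeft ((-1) ^ m))).sum_comp
      (fun y => (Fintype.card F : ℚ) ^ (d + 1) *
        toeplitzCount m ((b * (y ^ (d + 1))⁻¹ : Fˣ) : F))

theorem toeplitzCount_recursion {n : ℕ} (hn : 1 ≤ n) (b : Fˣ) :
    toeplitzCount n (b : F) = ∑ d ∈ Finset.range n, (Fintype.card F : ℚ) ^ (d + 1) *
      ∑ y : Fˣ, toeplitzCount (n - (d + 1)) ((b * (y ^ (d + 1))⁻¹ : Fˣ) : F) := by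
  rw [toeplitzCount, two_mul, seriesSum_eq_sum_order]
  have hlast : seriesSum n (fun u : PowerSeries F =>
      if toeplitzDet n (PowerSeries.X ^ n * u) = (b : F) then (1 : ℚ) else 0) = 0 := by
    simp [seriesSum, toeplitzDet_X_pow_mul hn, b.ne_zero.symm]
  rw [hlast, add_zero]
  refine Finset.sum_congr rfl fun d hd => ?_
  have hd : d < n := by simpa using hd
  rw [← seriesSum_toeplitz_stratum]
  rw [show 2 * (n - (d + 1)) + (d + 1) + 1 = n + n - d by omega,
    show d + 1 + (n - (d + 1)) = n by omega]

theorem toeplitzCount_zero (b : Fˣ) : toeplitzCount 0 (b : F) = if b = 1 then 1 else 0 := by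
  simp [toeplitzCount, seriesSum_zero, toeplitzDet, eq_comm]

end SeriesSum

section PowerProducts

variable {G : Type*} [CommGroup G] [Fintype G]

/-- The number of families `y` with `∏ y i ^ c i = b`, for a list of exponents `c`. -/
noncomputable def powCount : List ℕ → G → ℕ
  | [], b => if b = 1 then 1 else 0
  | c :: l, b => ∑ y : G, powCount l (b * (y ^ c)⁻¹)

theorem foldr_gcd_dvd (l : List ℕ) (N : ℕ) : l.foldr Nat.gcd N ∣ N := by
  induction l with
  | nil => exact dvd_rfl
  | cons c l ih => exact (Nat.gcd_dvd_right _ _).trans ih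

variable [IsCyclic G]

theorem exists_pow_eq_iff_pow_eq_one {d : ℕ} (hd : d ∣ Nat.card G) (b : G) :
    (∃ z, z ^ d = b) ↔ b ^ (Nat.card G / d) = 1 := by
  have hle : (powMonoidHom d : G →* G).range ≤ (powMonoidHom (Nat.card G / d) : G →* G).ker := by
    rintro _ ⟨z, rfl⟩
    rw [MonoidHom.mem_ker, powMonoidHom_apply, powMonoidHom_apply, ← pow_mul,
      Nat.mul_div_cancel' hd, pow_card_eq_one']
  have heq := Subgroup.eq_of_le_of_card_ge hle (by
    rw [IsCyclic.card_powMonoidHom_ker, IsCyclic.card_powMonoidHom_range,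
      Nat.gcd_eq_right (Nat.div_dvd_of_dvd hd), Nat.gcd_eq_right hd])
  have := SetLike.ext_iff.mp heq b
  simpa [MonoidHom.mem_ker] using this

theorem dvd_card_div_orderOf_iff {d : ℕ} (hd : d ∣ Nat.card G) (b : G) :
    d ∣ Nat.card G / orderOf b ↔ ∃ z, z ^ d = b := by
  rw [exists_pow_eq_iff_pow_eq_one hd, ← orderOf_dvd_iff_pow_eq_one,
    Nat.dvd_div_iff_mul_dvd (orderOf_dvd_natCard b), Nat.dvd_div_iff_mul_dvd hd, mul_comm]

theorem card_pow_eq_one_eq_gcd (k : ℕ) :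
    (Finset.univ.filter fun y : G => y ^ k = 1).card = (Nat.card G).gcd k := by
  rw [← IsCyclic.card_powMonoidHom_ker, ← Fintype.card_subtype, ← Nat.card_eq_fintype_card]
  exact Nat.card_congr (Equiv.subtypeEquivRight fun y => by simp [MonoidHom.mem_ker])

theorem sum_ite_exists_pow_eq {d : ℕ} (hd : d ∣ Nat.card G) (c : ℕ) (b : G) :
    (∑ y : G, if ∃ z, z ^ d = b * (y ^ c)⁻¹ then d else 0) =
      Nat.card G * if ∃ z, z ^ c.gcd d = b then c.gcd d else 0 := by
  by_cases hb : ∃ z, z ^ c.gcd d = b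
  · obtain ⟨t, ht⟩ := hb
    rw [if_pos ⟨t, ht⟩]
    set y₀ : G := t ^ c.gcdA d
    set z₀ : G := t ^ c.gcdB d
    have hbz : b = y₀ ^ c * z₀ ^ d := by
      rw [← ht, ← zpow_natCast, Nat.gcd_eq_gcd_ab, zpow_add, mul_comm (c : ℤ), mul_comm (d : ℤ),
        zpow_mul, zpow_mul, zpow_natCast, zpow_natCast]
    have hiff (w : G) : (∃ z, z ^ d = b * ((y₀ * w) ^ c)⁻¹) ↔ w ^ (c * (Nat.card G / d)) = 1 := by
      rw [pow_mul, ← exists_pow_eq_iff_pow_eq_one hd]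
      have : b * ((y₀ * w) ^ c)⁻¹ = z₀ ^ d * (w ^ c)⁻¹ := by
        rw [hbz, mul_pow, mul_inv]
        group
        rw [mul_comm (y₀ ^ (c : ℤ)), mul_assoc (z₀ ^ (d : ℤ)), ← zpow_add]
        simp
      rw [this]
      constructor
      · rintro ⟨z, hz⟩
        refine ⟨z₀ * z⁻¹, ?_⟩
        rw [mul_pow, inv_pow, hz]; simp
      · rintro ⟨z, hz⟩
        exact ⟨z₀ * z⁻¹, by rw [mul_pow, inv_pow, hz]⟩
    rw [← Equiv.sum_comp (Equiv.mulLeft y₀)]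
    simp only [Equiv.coe_mulLeft, hiff]
    rw [← Finset.sum_filter, Finset.sum_const, card_pow_eq_one_eq_gcd, smul_eq_mul]
    obtain ⟨e, he⟩ := hd
    have hd0 : 0 < d := Nat.pos_of_ne_zero fun h => by
      rw [h, zero_mul] at he; exact Nat.card_pos.ne' he
    rw [he, Nat.mul_div_cancel_left _ hd0, Nat.gcd_mul_right, Nat.gcd_comm d c]
    ring
  · rw [if_neg hb, mul_zero]
    refine Finset.sum_eq_zero fun y _ => if_neg ?_
    rintro ⟨z, hz⟩
    refine hb ⟨z ^ (d / c.gcd d) * y ^ (c / c.gcd d), ?_⟩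
    rw [mul_pow, ← pow_mul, ← pow_mul, Nat.div_mul_cancel (Nat.gcd_dvd_right _ _),
      Nat.div_mul_cancel (Nat.gcd_dvd_left _ _), hz]
    simp

theorem powCount_mul_card (l : List ℕ) (b : G) :
    powCount l b * Nat.card G = Nat.card G ^ l.length *
      if l.foldr Nat.gcd (Nat.card G) ∣ Nat.card G / orderOf b
        then l.foldr Nat.gcd (Nat.card G) else 0 := by
  simp only [dvd_card_div_orderOf_iff (foldr_gcd_dvd l _)]
  induction l generalizing b with
  | nil => simp [powCount, eq_comm]
  | cons c l ih =>
    rw [powCount, Finset.sum_mul]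
    simp only [ih, ← Finset.mul_sum]
    rw [sum_ite_exists_pow_eq (foldr_gcd_dvd l _), List.length_cons, pow_succ, mul_assoc]
    rfl

end PowerProducts

theorem sum_composition_eq {n : ℕ} (hn : 1 ≤ n) (w : List ℕ → ℚ) :
    ∑ c : Composition n, w c.blocks =
      ∑ d ∈ Finset.range n, ∑ c : Composition (n - (d + 1)), w ((d + 1) :: c.blocks) := by
  rw [Finset.sum_sigma']
  symm
  refine Finset.sum_bij (fun p hp => ⟨(p.1 + 1) :: p.2.blocks, ?_, ?_⟩) ?_ ?_ ?_ ?_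
  · intro i hi
    rcases List.mem_cons.mp hi with rfl | hi
    · omega
    · exact p.2.blocks_pos hi
  · have : p.1 < n := by simpa using hp
    rw [List.sum_cons, p.2.blocks_sum]; omega
  · intros; simp
  · rintro ⟨d, c⟩ _ ⟨d', c'⟩ _ h
    simp only [Composition.mk.injEq, List.cons.injEq, add_left_inj] at h
    obtain ⟨rfl, h⟩ := h
    rw [Composition.ext h]
  · rintro ⟨l, hpos, hsum⟩ _
    cases l with
    | nil => simp at hsum; omega
    | cons a l =>
      have ha : 0 < a := hpos (by simp)
      rw [List.sum_cons] at hsum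
      refine ⟨⟨a - 1, ⟨l, fun h => hpos (List.mem_cons_of_mem _ h), by omega⟩⟩, ?_, ?_⟩
      · simp; omega
      · simp; omega
  · intros; rfl

section Rectangle

variable {F : Type*} [Field F]

theorem det_JTmat_rectangle {a n : ℕ} (hn : 1 ≤ n) (han : n ≤ a)
    (t : Fin (a + (n - 1)) → F) :
    (JTmat F n (fun _ => a) (extFin t)).det =
      toeplitzDet n (dropCoeffs (a - n) (truncSeries t)) := by
  unfold toeplitzDet
  congr 1
  ext i j
  simp only [JTmat, Matrix.of_apply, coeff_dropCoeffs, Fin.val_rev]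
  rw [if_pos (by omega), show ((a : ℤ) - i + j).toNat = a - i + j by omega, extFin,
    dif_pos (by omega), coeff_truncSeries _ (by omega)]
  congr 2
  omega

variable [Fintype F]

theorem toeplitzCount_eq_sum_powCount (n : ℕ) (b : Fˣ) :
    toeplitzCount n (b : F) =
      (Fintype.card F : ℚ) ^ n * ∑ c : Composition n, (powCount c.blocks b : ℚ) := by
  induction n using Nat.strong_induction_on generalizing b with
  | _ n ih =>
    rcases Nat.eq_zero_or_pos n with rfl | hn
    · rw [toeplitzCount_zero]
      have hnil (c : Composition 0) : c.blocks = [] := by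
        simp
      simp [hnil, powCount, composition_card]
    · rw [toeplitzCount_recursion hn, sum_composition_eq hn (fun l => (powCount l b : ℚ)),
        Finset.mul_sum]
      refine Finset.sum_congr rfl fun d hd => ?_
      have hd : d < n := by simpa using hd
      simp only [powCount, Nat.cast_sum]
      rw [Finset.sum_comm, Finset.mul_sum, Finset.mul_sum]
      refine Finset.sum_congr rfl fun y _ => ?_
      rw [ih _ (by omega), ← mul_assoc, ← pow_add, show d + 1 + (n - (d + 1)) = n by omega]

theorem probEq_rectangle {a n : ℕ} (hn : 1 ≤ n) (han : n ≤ a) (b : F) :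
    probEq F n (fun _ => a) (a + (n - 1)) b =
      toeplitzCount n b / (Fintype.card F : ℚ) ^ (2 * n) := by
  have hq : (Fintype.card F : ℚ) ≠ 0 := Nat.cast_ne_zero.mpr Fintype.card_ne_zero
  have h1 : (((Finset.univ.filter fun t : Fin (a + (n - 1)) → F =>
      (JTmat F n (fun _ => a) (extFin t)).det = b).card : ℕ) : ℚ) =
      seriesSum (2 * n - 1 + (a - n)) fun h : PowerSeries F =>
        if toeplitzDet n (dropCoeffs (a - n) h) = b then 1 else 0 := by
    rw [show 2 * n - 1 + (a - n) = a + (n - 1) by omega, seriesSum, Finset.card_filter]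
    push_cast
    refine Finset.sum_congr rfl fun t _ => ?_
    rw [det_JTmat_rectangle hn han]
  have h2 : toeplitzCount n b = Fintype.card F * seriesSum (2 * n - 1) fun h : PowerSeries F =>
      if toeplitzDet n h = b then 1 else 0 := by
    rw [toeplitzCount, show 2 * n = 2 * n - 1 + 1 by omega, seriesSum_succ_of_congr]
    · rw [Nat.add_sub_cancel]
    · intro h k hk
      rw [toeplitzDet_congr fun i hi => hk i (by omega)]
  rw [probEq, h1, seriesSum_dropCoeffs (a - n) (2 * n - 1) (fun h : PowerSeries F =>
    if toeplitzDet n h = b then 1 else 0), h2,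
    show a + (n - 1) = 2 * n - 1 + (a - n) by omega, show 2 * n = 2 * n - 1 + 1 by omega,
    Nat.add_sub_cancel, pow_add, pow_succ]
  field_simp

end Rectangle

/-- For a rectangle `(aⁿ)` with `a ≥ n ≥ 1` and nonzero `b ∈ 𝔽_q`,
`P(s_{(aⁿ)} ↦ b) = Σ_{compositions (c_1,…,c_k) of n}
  (q−1)^{k−1}/qⁿ · g_b(gcd(c_1, …, c_k, q−1))`. -/
theorem prob_rectangle_nonzero (F : Type*) [Field F] [Fintype F]
    (b : F) (hb : b ≠ 0) (a n : ℕ) (hn : 1 ≤ n) (han : n ≤ a) :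
    probEq F n (fun _ => a) (a + (n - 1)) b =
      ∑ c : Composition n,
        ((Fintype.card F : ℚ) - 1) ^ (c.length - 1) / (Fintype.card F : ℚ) ^ n *
          (gVal (Fintype.card F) (orderOf b)
            (c.blocks.foldr Nat.gcd (Fintype.card F - 1)) : ℚ) := by
  lift b to Fˣ using hb.isUnit
  have hq : (Fintype.card F : ℚ) ≠ 0 := Nat.cast_ne_zero.mpr Fintype.card_ne_zero
  have hq1 : (Fintype.card F : ℚ) - 1 ≠ 0 :=
    sub_ne_zero.mpr (by exact_mod_cast Fintype.one_lt_card.ne')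
  have hcard : Nat.card Fˣ = Fintype.card F - 1 := by
    rw [Nat.card_eq_fintype_card, Fintype.card_units]
  rw [probEq_rectangle hn han, toeplitzCount_eq_sum_powCount, two_mul, pow_add,
    mul_div_mul_left _ _ (pow_ne_zero _ hq), Finset.sum_div]
  refine Finset.sum_congr rfl fun c _ => ?_
  have key := powCount_mul_card c.blocks b
  rw [hcard, ← orderOf_units] at key
  have key' : (powCount c.blocks b : ℚ) * ((Fintype.card F : ℚ) - 1) =
      ((Fintype.card F : ℚ) - 1) ^ c.length * (gVal (Fintype.card F) (orderOf (b : F))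
        (c.blocks.foldr Nat.gcd (Fintype.card F - 1)) : ℚ) := by
    rw [← Nat.cast_pred Fintype.card_pos]
    exact_mod_cast key
  have hlen : c.length = c.length - 1 + 1 := by
    have := c.length_pos_of_pos hn
    omega
  rw [hlen, pow_succ, mul_right_comm] at key'
  rw [mul_right_cancel₀ hq1 key', div_mul_eq_mul_div]
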